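/- Let (b_n)_{n≥0} and (λ_n)_{n≥0} be sequences of positive integers satisfying b_n → ∞, λ_n → ∞, and log b_{n+1}/(∑_{k=0}^{n} λ_k log b_k) → ∞. Let ξ = [0; b₀^{λ₀}, b₁^{λ₁}, …] and for n ≥ 0 let α_n = [0; b₀^{λ₀}, …, bₙ^{λₙ}, \overline{b_{n+1}}] be the quadratic number whose continued fraction agrees with ξ up to the n-th block and then has b_{n+1} repeated forever. Then for all sufficiently large n: 0 < |ξ − α_n| ≤ H(α_n)^{−2λ_{n+1}/3}. -/

import Mathlib

open Filter Finset Polynomial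

/-- Numerators of the convergents of the continued fraction `[a 0; a 1, a 2, …]`. -/
def convP (a : ℕ → ℤ) : ℕ → ℤ
  | 0 => a 0
  | 1 => a 1 * a 0 + 1
  | (n+2) => a (n+2) * convP a (n+1) + convP a n

/-- Denominators of the convergents of the continued fraction `[a 0; a 1, a 2, …]`. -/
def convQ (a : ℕ → ℤ) : ℕ → ℤ
  | 0 => 1
  | 1 => a 1
  | (n+2) => a (n+2) * convQ a (n+1) + convQ a n

/-- `ξ` is the value of the continued fraction with partial quotients `a`,
i.e. the limit of its convergents. -/
def IsCFValue (a : ℕ → ℤ) (ξ : ℝ) : Prop :=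
  Filter.Tendsto (fun n => (convP a n : ℝ) / (convQ a n : ℝ)) Filter.atTop (nhds ξ)

/-- Naive height of an integer polynomial: max of the absolute values of its coefficients. -/
def polyHeight (P : Polynomial ℤ) : ℕ := P.support.sup fun i => (P.coeff i).natAbs

/-- Naive height of a real algebraic number: the height of its minimal polynomial over `ℤ`
(an irreducible integer polynomial vanishing at `α`). -/
noncomputable def algHeight (α : ℝ) : ℕ :=
  sInf {h | ∃ P : Polynomial ℤ, Irreducible P ∧ Polynomial.aeval α P = 0 ∧ polyHeight P = h}

/-- `α` is algebraic of degree exactly `n` over `ℚ`. -/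
def IsAlgDeg (α : ℝ) (n : ℕ) : Prop :=
  ∃ P : Polynomial ℤ, Irreducible P ∧ P.natDegree = n ∧ Polynomial.aeval α P = 0

/-! ### Basic continuant facts -/

lemma convP_add (a : ℕ → ℤ) (K m : ℕ) :
    convP a (K + 2 + m) = convP a (K + 1) * convP (fun i => a (K + 2 + i)) m
      + convP a K * convQ (fun i => a (K + 2 + i)) m := by
  induction m using Nat.strong_induction_on with
  | _ m ih =>
    match m with
    | 0 => simp [convP, convQ]; ring
    | 1 =>
      have h : K + 2 + 1 = (K + 1) + 2 := by ring
      rw [h, convP, convP, convP, convQ, h]; simp only [add_zero]; ring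
    | m + 2 =>
      have h1 := ih m (by omega)
      have h2 := ih (m + 1) (by omega)
      have h : K + 2 + (m + 2) = (K + 2 + m) + 2 := by ring
      have h' : K + 2 + m + 1 = K + 2 + (m + 1) := by ring
      rw [h, convP, h', h1, h2, convP, convQ]
      simp only [h]; ring

lemma convQ_add (a : ℕ → ℤ) (K m : ℕ) :
    convQ a (K + 2 + m) = convQ a (K + 1) * convP (fun i => a (K + 2 + i)) m
      + convQ a K * convQ (fun i => a (K + 2 + i)) m := by
  induction m using Nat.strong_induction_on with
  | _ m ih =>
    match m with
    | 0 => simp [convP, convQ]; ring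
    | 1 =>
      have h : K + 2 + 1 = (K + 1) + 2 := by ring
      rw [h, convQ, convQ, convP, convQ, h]; simp only [add_zero]; ring
    | m + 2 =>
      have h1 := ih m (by omega)
      have h2 := ih (m + 1) (by omega)
      have h : K + 2 + (m + 2) = (K + 2 + m) + 2 := by ring
      have h' : K + 2 + m + 1 = K + 2 + (m + 1) := by ring
      rw [h, convQ, h', h1, h2, convP, convQ]
      simp only [h]; ring

lemma conv_det (a : ℕ → ℤ) (K : ℕ) :
    (convP a (K + 1) * convQ a K - convP a K * convQ a (K + 1)) ^ 2 = 1 := by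
  induction K with
  | zero => simp only [convP, convQ]; ring
  | succ K ih => rw [convP, convQ, ← ih]; ring

lemma convQ_pos (a : ℕ → ℤ) (h : ∀ i, 1 ≤ a (i + 1)) (n : ℕ) : 1 ≤ convQ a n := by
  induction n using Nat.strong_induction_on with
  | _ n ih =>
    match n with
    | 0 => simp [convQ]
    | 1 => simpa [convQ] using h 0
    | n + 2 =>
      rw [convQ]
      nlinarith [ih n (by omega), ih (n + 1) (by omega), h (n + 1)]

lemma convP_nonneg (a : ℕ → ℤ) (h0 : 0 ≤ a 0) (h : ∀ i, 1 ≤ a (i + 1)) (n : ℕ) :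
    0 ≤ convP a n := by
  induction n using Nat.strong_induction_on with
  | _ n ih =>
    match n with
    | 0 => simpa [convP]
    | 1 => simp only [convP]; nlinarith [h 0]
    | n + 2 =>
      rw [convP]
      nlinarith [ih n (by omega), ih (n + 1) (by omega), h (n + 1)]

lemma convP_le_convQ (a : ℕ → ℤ) (h0 : a 0 = 0) (h : ∀ i, 1 ≤ a (i + 1)) (n : ℕ) :
    convP a n ≤ convQ a n := by
  induction n using Nat.strong_induction_on with
  | _ n ih =>
    match n with
    | 0 => simp [convP, convQ, h0]
    | 1 => simp only [convP, convQ, h0]; linarith [h 0]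
    | n + 2 =>
      rw [convP, convQ]
      nlinarith [ih n (by omega), ih (n + 1) (by omega), h (n + 1)]

lemma convQ_succ_le (a : ℕ → ℤ) (h : ∀ i, 1 ≤ a (i + 1)) (n : ℕ) :
    convQ a (n + 1) ≤ (a (n + 1) + 1) * convQ a n := by
  match n with
  | 0 => simp [convQ]
  | n + 1 =>
    have h1 : convQ a n ≤ convQ a (n + 1) := by
      match n with
      | 0 => simpa [convQ] using h 0
      | n + 1 =>
        rw [convQ]
        nlinarith [convQ_pos a h n, convQ_pos a h (n + 1), h (n + 1)]
    rw [convQ]; linarith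

lemma le_convQ_succ (a : ℕ → ℤ) (h : ∀ i, 1 ≤ a (i + 1)) (n : ℕ) :
    a (n + 1) * convQ a n ≤ convQ a (n + 1) := by
  match n with
  | 0 => simp [convQ]
  | n + 1 => rw [convQ]; linarith [convQ_pos a h n]

lemma convQ_mono (a : ℕ → ℤ) (h : ∀ i, 1 ≤ a (i + 1)) (n : ℕ) :
    convQ a n ≤ convQ a (n + 1) := by
  nlinarith [le_convQ_succ a h n, convQ_pos a h n, h n]

/-- `c 0 * Q ≤ P`. -/
lemma conv_lower (c : ℕ → ℤ) (h : ∀ i, 1 ≤ c (i + 1)) (n : ℕ) :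
    c 0 * convQ c n ≤ convP c n := by
  induction n using Nat.strong_induction_on with
  | _ n ih =>
    match n with
    | 0 => simp [convP, convQ]
    | 1 => simp only [convP, convQ]; linarith [mul_comm (c 0) (c 1)]
    | n + 2 =>
      rw [convP, convQ]
      nlinarith [ih n (by omega), ih (n + 1) (by omega), h (n + 1)]

/-- `c 1 * (P - c 0 * Q) ≤ Q`. -/
lemma conv_upper (c : ℕ → ℤ) (h : ∀ i, 1 ≤ c (i + 1)) (n : ℕ) :
    c 1 * (convP c n - c 0 * convQ c n) ≤ convQ c n := by
  induction n using Nat.strong_induction_on with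
  | _ n ih =>
    match n with
    | 0 => simp [convP, convQ]
    | 1 => simp only [convP, convQ]; apply le_of_eq; ring
    | n + 2 =>
      rw [convP, convQ]
      nlinarith [ih n (by omega), ih (n + 1) (by omega), h (n + 1)]

lemma convP_const (b : ℤ) (n : ℕ) :
    convP (fun _ => b) n = convQ (fun _ => b) (n + 1) := by
  induction n using Nat.strong_induction_on with
  | _ n ih =>
    match n with
    | 0 => simp [convP, convQ]
    | 1 => simp [convP, convQ]
    | n + 2 =>
      rw [convP, convQ, ih n (by omega), ih (n + 1) (by omega)]

lemma const_norm (b : ℤ) (n : ℕ) :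
    (convP (fun _ => b) n ^ 2 - b * convP (fun _ => b) n * convQ (fun _ => b) n
      - convQ (fun _ => b) n ^ 2) ^ 2 = 1 := by
  rw [convP_const]
  induction n with
  | zero => simp only [convQ]; ring
  | succ n ih => rw [convQ, ← ih]; ring

lemma le_convQ_const (b : ℤ) (hb : 2 ≤ b) (n : ℕ) : (n : ℤ) + 1 ≤ convQ (fun _ => b) n := by
  induction n with
  | zero => simp [convQ]
  | succ n ih =>
    have := le_convQ_succ (fun _ => b) (fun _ => by omega) n
    push_cast
    nlinarith

lemma convP_congr (a c : ℕ → ℤ) (n : ℕ) (h : ∀ i ≤ n, a i = c i) : convP a n = convP c n := by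
  induction n using Nat.strong_induction_on with
  | _ n ih =>
    match n with
    | 0 => simp [convP, h]
    | 1 => simp [convP, h]
    | n + 2 =>
      rw [convP, convP, ih n (by omega) (fun i hi => h i (by omega)),
        ih (n + 1) (by omega) (fun i hi => h i (by omega)), h _ le_rfl]

lemma convQ_congr (a c : ℕ → ℤ) (n : ℕ) (h : ∀ i ≤ n, a i = c i) : convQ a n = convQ c n := by
  induction n using Nat.strong_induction_on with
  | _ n ih =>
    match n with
    | 0 => simp [convQ]
    | 1 => simp [convQ, h]
    | n + 2 =>
      rw [convQ, convQ, ih n (by omega) (fun i hi => h i (by omega)),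
        ih (n + 1) (by omega) (fun i hi => h i (by omega)), h _ le_rfl]

/-! ### Height bound -/

lemma polyHeight_le_of (P : ℤ[X]) (h : ℕ) (hP : ∀ i, (P.coeff i).natAbs ≤ h) :
    polyHeight P ≤ h := Finset.sup_le fun i _ => hP i

lemma coeff_le_polyHeight (P : ℤ[X]) (i : ℕ) : (P.coeff i).natAbs ≤ polyHeight P := by
  by_cases h : i ∈ P.support
  · exact Finset.le_sup (f := fun i => (P.coeff i).natAbs) h
  · simp [Polynomial.notMem_support_iff.mp h]

lemma exists_irred_factor (x : ℝ) (Q : ℤ[X]) (hQ : Q ≠ 0) (hx : aeval x Q = 0) :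
    ∃ P, Irreducible P ∧ P ∣ Q ∧ aeval x P = 0 := by
  induction Q using WfDvdMonoid.induction_on_irreducible with
  | zero => exact absurd rfl hQ
  | unit u hu =>
    exfalso
    have := hu.map (aeval x : ℤ[X] →ₐ[ℤ] ℝ)
    rw [hx] at this
    exact not_isUnit_zero this
  | mul Q P hQ0 hP ih =>
    rw [map_mul, mul_eq_zero] at hx
    rcases hx with hx | hx
    · exact ⟨P, hP, dvd_mul_right _ _, hx⟩
    · obtain ⟨R, h1, h2, h3⟩ := ih hQ0 hx
      exact ⟨R, h1, h2.mul_left _, h3⟩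

lemma algHeight_bound (x : ℝ) (hx0 : |x| ≤ 1) (Q : ℤ[X]) (hQ : Q ≠ 0) (hdeg : Q.natDegree ≤ 2)
    (hx : aeval x Q = 0) : 1 ≤ algHeight x ∧ algHeight x ≤ polyHeight Q := by
  obtain ⟨P, hP, ⟨R, hR⟩, hPx⟩ := exists_irred_factor x Q hQ hx
  constructor
  · have hne : {h | ∃ P : ℤ[X], Irreducible P ∧ aeval x P = 0 ∧ polyHeight P = h}.Nonempty :=
      ⟨_, P, hP, hPx, rfl⟩
    obtain ⟨P', h1, -, h3⟩ := Nat.sInf_mem hne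
    rw [algHeight, ← h3]
    have := coeff_le_polyHeight P' P'.natDegree
    have h4 : P'.coeff P'.natDegree ≠ 0 := by
      simpa using h1.ne_zero
    have := Int.natAbs_pos.mpr h4
    omega
  · refine le_trans (Nat.sInf_le ⟨P, hP, hPx, rfl⟩) ?_
    have hR0 : R ≠ 0 := by rintro rfl; simp [hQ] at hR
    have hd : Q.natDegree = P.natDegree + R.natDegree := by
      rw [hR, natDegree_mul hP.ne_zero hR0]
    have hlead : P.leadingCoeff.natAbs ≤ polyHeight Q := by
      refine le_trans ?_ (coeff_le_polyHeight Q Q.natDegree)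
      have : Q.coeff Q.natDegree = P.leadingCoeff * R.leadingCoeff := by
        rw [coeff_natDegree, hR, leadingCoeff_mul]
      rw [this, Int.natAbs_mul]
      exact Nat.le_mul_of_pos_right _ (Int.natAbs_pos.mpr (by simpa using hR0))
    have hcases : P.natDegree = 0 ∨ P.natDegree = 1 ∨ R.natDegree = 0 := by omega
    rcases hcases with h | h | h
    · exfalso
      rw [eq_C_of_natDegree_eq_zero h] at hPx
      simp at hPx
      apply hP.ne_zero
      rw [eq_C_of_natDegree_eq_zero h, hPx, C_0]
    · have h1 : (P.coeff 1).natAbs ≤ polyHeight Q := by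
        rw [leadingCoeff, h] at hlead; exact hlead
      apply polyHeight_le_of
      intro i
      match i with
      | 0 =>
        refine le_trans ?_ h1
        rw [eq_X_add_C_of_natDegree_le_one h.le] at hPx
        simp at hPx
        have h2 : (P.coeff 0 : ℝ) = - (P.coeff 1 * x) := by linarith
        have h3 : |(P.coeff 0 : ℝ)| ≤ |(P.coeff 1 : ℝ)| := by
          rw [h2, abs_neg, abs_mul]
          exact mul_le_of_le_one_right (abs_nonneg _) hx0
        have h4 : |P.coeff 0| ≤ |P.coeff 1| := by exact_mod_cast h3
        rw [Int.abs_eq_natAbs, Int.abs_eq_natAbs] at h4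
        exact_mod_cast h4
      | 1 => exact h1
      | i + 2 => rw [coeff_eq_zero_of_natDegree_lt (by omega)]; simp
    · apply polyHeight_le_of
      intro i
      refine le_trans ?_ (coeff_le_polyHeight Q i)
      rw [eq_C_of_natDegree_eq_zero h] at hR
      have h0 : R.coeff 0 ≠ 0 := by
        intro h0; apply hR0; rw [eq_C_of_natDegree_eq_zero h, h0, C_0]
      rw [hR, coeff_mul_C, Int.natAbs_mul]
      exact Nat.le_mul_of_pos_right _ (Int.natAbs_pos.mpr h0)

lemma algHeight_quad (x : ℝ) (hx0 : |x| ≤ 1) (A B C' : ℤ) (hne : A ≠ 0 ∨ B ≠ 0 ∨ C' ≠ 0)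
    (hx : (A : ℝ) * x ^ 2 + B * x + C' = 0) (h : ℕ) (hA : |A| ≤ h) (hB : |B| ≤ h)
    (hC : |C'| ≤ h) : 1 ≤ algHeight x ∧ algHeight x ≤ h := by
  set Q : ℤ[X] := C A * X ^ 2 + C B * X + C C' with hQ
  have c0 : Q.coeff 0 = C' := by simp [hQ]
  have c1 : Q.coeff 1 = B := by simp [hQ, -map_intCast, -eq_intCast, coeff_C]
  have c2 : Q.coeff 2 = A := by simp [hQ, -map_intCast, -eq_intCast]
  have hd : Q.natDegree ≤ 2 := natDegree_quadratic_le
  obtain ⟨h1, h2⟩ := algHeight_bound x hx0 Q (by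
    intro h0
    simp [h0] at c0 c1 c2
    omega) hd (by simpa [hQ] using hx)
  rw [Int.abs_eq_natAbs] at hA hB hC
  refine ⟨h1, h2.trans (polyHeight_le_of _ _ fun i => ?_)⟩
  match i with
  | 0 => rw [c0]; omega
  | 1 => rw [c1]; omega
  | 2 => rw [c2]; omega
  | i + 3 => rw [coeff_eq_zero_of_natDegree_lt (by omega)]; simp

/-! ### Approximation -/

lemma core_upper (p p' q q' P Q R S : ℝ) (hdet : (p * q' - p' * q) ^ 2 = 1) (hq : 1 ≤ q)
    (hq' : 1 ≤ q') (hQ : 1 ≤ Q) (hS : 1 ≤ S) (hPQ : Q ≤ P) (hRS : S ≤ R) :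
    |(p * P + p' * Q) / (q * P + q' * Q) - (p * R + p' * S) / (q * R + q' * S)| ≤ 1 / q ^ 2 := by
  have hP : 0 < P := by linarith
  have hR : 0 < R := by linarith
  have hD : 0 < q * P + q' * Q := by positivity
  have hE : 0 < q * R + q' * S := by positivity
  have habs : |p * q' - p' * q| = 1 := by
    rw [← sq_abs] at hdet
    nlinarith [abs_nonneg (p * q' - p' * q)]
  have : (p * P + p' * Q) / (q * P + q' * Q) - (p * R + p' * S) / (q * R + q' * S)
      = (p * q' - p' * q) * (P * S - R * Q) / ((q * P + q' * Q) * (q * R + q' * S)) := by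
    field_simp; ring
  rw [this, abs_div, abs_mul, habs, one_mul, abs_of_pos (mul_pos hD hE),
    div_le_div_iff₀ (mul_pos hD hE) (by positivity), one_mul]
  have h1 : |P * S - R * Q| ≤ P * R := by
    rw [abs_le]
    constructor
    · nlinarith [mul_pos hP (show 0 < S by linarith)]
    · nlinarith [mul_pos hR (show 0 < Q by linarith)]
  have h2 : (q * P) * (q * R) ≤ (q * P + q' * Q) * (q * R + q' * S) := by
    have : 0 < q' * Q := by positivity
    have : 0 < q' * S := by positivity
    gcongr <;> linarith
  calc |P * S - R * Q| * q ^ 2 ≤ P * R * q ^ 2 := by gcongr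
    _ = (q * P) * (q * R) := by ring
    _ ≤ _ := h2

lemma core_lower (p p' q q' P Q R S c d : ℝ) (hdet : (p * q' - p' * q) ^ 2 = 1) (hq : 1 ≤ q)
    (hq' : 1 ≤ q') (hQ : 1 ≤ Q) (hS : 1 ≤ S) (hd : 1 ≤ d) (hcd : d + 1 ≤ c)
    (hP1 : c * Q ≤ P) (hP2 : P ≤ (c + 1) * Q) (hR1 : d * S ≤ R) (hR2 : 2 * (R - d * S) ≤ S) :
    1 / (2 * ((q * (c + 1) + q') * (q * (d + 1) + q'))) ≤
    |(p * P + p' * Q) / (q * P + q' * Q) - (p * R + p' * S) / (q * R + q' * S)| := by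
  have hP : 0 < P := by nlinarith
  have hR : 0 < R := by nlinarith
  have hD : 0 < q * P + q' * Q := by positivity
  have hE : 0 < q * R + q' * S := by positivity
  have habs : |p * q' - p' * q| = 1 := by
    rw [← sq_abs] at hdet
    nlinarith [abs_nonneg (p * q' - p' * q)]
  have : (p * P + p' * Q) / (q * P + q' * Q) - (p * R + p' * S) / (q * R + q' * S)
      = (p * q' - p' * q) * (P * S - R * Q) / ((q * P + q' * Q) * (q * R + q' * S)) := by
    field_simp; ring
  have hc : 0 < c + 1 := by linarith
  have hd' : 0 < d + 1 := by linarith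
  have hQ0 : 0 < Q := by linarith
  have hS0 : 0 < S := by linarith
  rw [this, abs_div, abs_mul, habs, one_mul, abs_of_pos (mul_pos hD hE),
    div_le_div_iff₀ (by positivity) (mul_pos hD hE), one_mul]
  have h1 : Q * S / 2 ≤ |P * S - R * Q| := by
    refine le_trans ?_ (le_abs_self _)
    have e1 : c * Q * S ≤ P * S := by gcongr
    have e2 : 2 * (R - d * S) * Q ≤ S * Q := by gcongr
    have e3 : (d + 1) * (Q * S) ≤ c * (Q * S) := by gcongr
    nlinarith
  have e1 : q * P + q' * Q ≤ (q * (c + 1) + q') * Q := by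
    have : q * P ≤ q * ((c + 1) * Q) := by gcongr
    linarith
  have e2 : q * R + q' * S ≤ (q * (d + 1) + q') * S := by
    have : q * R ≤ q * ((d + 1) * S) := by gcongr; linarith
    linarith
  calc (q * P + q' * Q) * (q * R + q' * S)
      ≤ ((q * (c + 1) + q') * Q) * ((q * (d + 1) + q') * S) := by gcongr
    _ = (Q * S / 2) * (2 * ((q * (c + 1) + q') * (q * (d + 1) + q'))) := by ring
    _ ≤ _ := by gcongr

lemma approx (a a' : ℕ → ℤ) (K : ℕ) (ha : ∀ i, 1 ≤ a (i + 1)) (ha' : ∀ i, 1 ≤ a' (i + 1))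
    (hag : ∀ i ≤ K + 1, a' i = a i) (x y : ℝ) (hx : IsCFValue a x) (hy : IsCFValue a' y) :
    |x - y| ≤ 1 / (convQ a (K + 1) : ℝ) ^ 2 ∧
    (a' (K + 2) + 1 ≤ a (K + 2) → 2 ≤ a' (K + 3) → 0 < |x - y|) := by
  have hp1 := convP_congr a' a (K + 1) hag
  have hq1 := convQ_congr a' a (K + 1) hag
  have hp0 := convP_congr a' a K (fun i hi => hag i (by omega))
  have hq0 := convQ_congr a' a K (fun i hi => hag i (by omega))
  have hlim : Tendsto (fun m => |(convP a (m + (K + 2)) : ℝ) / (convQ a (m + (K + 2)) : ℝ)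
      - (convP a' (m + (K + 2)) : ℝ) / (convQ a' (m + (K + 2)) : ℝ)|) atTop (nhds |x - y|) :=
    (((tendsto_add_atTop_iff_nat (K + 2)).mpr hx).sub
      ((tendsto_add_atTop_iff_nat (K + 2)).mpr hy)).abs
  have hc : ∀ i, 1 ≤ (fun i => a (K + 2 + i)) (i + 1) := fun i => ha (K + 2 + i)
  have hc' : ∀ i, 1 ≤ (fun i => a' (K + 2 + i)) (i + 1) := fun i => ha' (K + 2 + i)
  have hdet : ((convP a (K + 1) : ℝ) * convQ a K - convP a K * convQ a (K + 1)) ^ 2 = 1 := by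
    exact_mod_cast conv_det a K
  have hq1' : (1 : ℝ) ≤ convQ a (K + 1) := by exact_mod_cast convQ_pos a ha (K + 1)
  have hq0' : (1 : ℝ) ≤ convQ a K := by exact_mod_cast convQ_pos a ha K
  have hQ : ∀ m, (1 : ℝ) ≤ convQ (fun i => a (K + 2 + i)) m := fun m => by
    exact_mod_cast convQ_pos _ hc m
  have hQ' : ∀ m, (1 : ℝ) ≤ convQ (fun i => a' (K + 2 + i)) m := fun m => by
    exact_mod_cast convQ_pos _ hc' m
  have hP1 : ∀ m, (a (K + 2) : ℝ) * convQ (fun i => a (K + 2 + i)) m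
      ≤ convP (fun i => a (K + 2 + i)) m := fun m => by
    exact_mod_cast conv_lower (fun i => a (K + 2 + i)) hc m
  have hP1' : ∀ m, (a' (K + 2) : ℝ) * convQ (fun i => a' (K + 2 + i)) m
      ≤ convP (fun i => a' (K + 2 + i)) m := fun m => by
    exact_mod_cast conv_lower (fun i => a' (K + 2 + i)) hc' m
  have h1 : (1 : ℝ) ≤ a (K + 2) := by exact_mod_cast ha (K + 1)
  have h1' : (1 : ℝ) ≤ a' (K + 2) := by exact_mod_cast ha' (K + 1)
  constructor
  · refine le_of_tendsto hlim (Eventually.of_forall fun m => ?_)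
    rw [add_comm m, convP_add, convP_add, convQ_add, convQ_add, hp1, hq1, hp0, hq0]
    push_cast
    refine core_upper _ _ _ _ _ _ _ _ hdet hq1' hq0' (hQ m) (hQ' m) ?_ ?_
    · nlinarith [hP1 m, hQ m]
    · nlinarith [hP1' m, hQ' m]
  · intro hlt h2
    have hlt' : (a' (K + 2) : ℝ) + 1 ≤ a (K + 2) := by exact_mod_cast hlt
    refine lt_of_lt_of_le (b := 1 / (2 * (((convQ a (K + 1) : ℝ) * (a (K + 2) + 1) + convQ a K)
      * (convQ a (K + 1) * (a' (K + 2) + 1) + convQ a K)))) (by positivity) ?_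
    refine ge_of_tendsto hlim (Eventually.of_forall fun m => ?_)
    rw [add_comm m, convP_add, convP_add, convQ_add, convQ_add, hp1, hq1, hp0, hq0]
    push_cast
    refine core_lower _ _ _ _ _ _ _ _ _ _ hdet hq1' hq0' (hQ m) (hQ' m) h1' hlt' (hP1 m) ?_
      (hP1' m) ?_
    · have h3 := conv_lower (fun i => a (K + 2 + i)) hc m
      have h4 := conv_upper (fun i => a (K + 2 + i)) hc m
      have h5 := hc 0
      simp only [add_zero, zero_add] at h3 h4 h5
      have : convP (fun i => a (K + 2 + i)) m
        ≤ (a (K + 2) + 1) * convQ (fun i => a (K + 2 + i)) m := by nlinarith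
      exact_mod_cast this
    · have h3 := conv_lower (fun i => a' (K + 2 + i)) hc' m
      have h4 := conv_upper (fun i => a' (K + 2 + i)) hc' m
      simp only [add_zero] at h3 h4
      have : 2 * (convP (fun i => a' (K + 2 + i)) m
        - a' (K + 2) * convQ (fun i => a' (K + 2 + i)) m)
        ≤ convQ (fun i => a' (K + 2 + i)) m := by nlinarith
      exact_mod_cast this

lemma quad_root (a : ℕ → ℤ) (K : ℕ) (b : ℤ) (hb : 2 ≤ b) (ha : ∀ i, 1 ≤ a (i + 1))
    (hconst : ∀ i, a (K + 2 + i) = b) (y : ℝ) (hy : IsCFValue a y) :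
    ((convQ a K : ℝ) * y - convP a K) ^ 2
      - b * (convQ a K * y - convP a K) * (convP a (K + 1) - convQ a (K + 1) * y)
      - (convP a (K + 1) - convQ a (K + 1) * y) ^ 2 = 0 := by
  set F : ℝ → ℝ := fun y => ((convQ a K : ℝ) * y - convP a K) ^ 2
      - b * (convQ a K * y - convP a K) * (convP a (K + 1) - convQ a (K + 1) * y)
      - (convP a (K + 1) - convQ a (K + 1) * y) ^ 2 with hF
  have hcont : Continuous F := by fun_prop
  have hlim : Tendsto (fun m => F ((convP a (m + (K + 2)) : ℝ) / (convQ a (m + (K + 2)) : ℝ)))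
      atTop (nhds (F y)) :=
    (hcont.tendsto y).comp ((tendsto_add_atTop_iff_nat (K + 2)).mpr hy)
  refine tendsto_nhds_unique hlim ?_
  refine squeeze_zero_norm (fun m => ?_) tendsto_one_div_add_atTop_nhds_zero_nat
  have hshift : (fun i => a (K + 2 + i)) = fun _ => b := funext hconst
  rw [add_comm m, convP_add, convQ_add, hshift]
  push_cast
  have hdet : ((convP a (K + 1) : ℝ) * convQ a K - convP a K * convQ a (K + 1)) ^ 2 = 1 := by
    exact_mod_cast conv_det a K
  have hq1' : (1 : ℝ) ≤ convQ a (K + 1) := by exact_mod_cast convQ_pos a ha (K + 1)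
  have hq0' : (1 : ℝ) ≤ convQ a K := by exact_mod_cast convQ_pos a ha K
  have hQ : (m : ℝ) + 1 ≤ convQ (fun _ => b) m := by exact_mod_cast le_convQ_const b hb m
  have hP : (0 : ℝ) ≤ convP (fun _ => b) m := by
    exact_mod_cast convP_nonneg (fun _ => b) (by omega) (fun _ => by omega) m
  have hN : ((convP (fun _ => b) m : ℝ) ^ 2 - b * convP (fun _ => b) m * convQ (fun _ => b) m
      - convQ (fun _ => b) m ^ 2) ^ 2 = 1 := by exact_mod_cast const_norm b m
  generalize (convP (fun _ => b) m : ℝ) = P at *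
  generalize (convQ (fun _ => b) m : ℝ) = Q at *
  generalize (convP a (K + 1) : ℝ) = p at *
  generalize (convQ a (K + 1) : ℝ) = q at *
  generalize (convP a K : ℝ) = p' at *
  generalize (convQ a K : ℝ) = q' at *
  have hm : (0 : ℝ) ≤ m := Nat.cast_nonneg m
  have hD1 : (m : ℝ) + 1 ≤ q * P + q' * Q := by
    have : 0 ≤ q * P := by positivity
    nlinarith
  have hD : 0 < q * P + q' * Q := by linarith
  have e1 : F ((p * P + p' * Q) / (q * P + q' * Q))
      = (p * q' - p' * q) ^ 2 * (P ^ 2 - b * P * Q - Q ^ 2) / (q * P + q' * Q) ^ 2 := by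
    have hDne : q * P + q' * Q ≠ 0 := hD.ne'
    have u1 : q' * ((p * P + p' * Q) / (q * P + q' * Q)) - p'
        = (p * q' - p' * q) * P / (q * P + q' * Q) := by
      rw [eq_div_iff hDne, sub_mul, mul_assoc, div_mul_cancel₀ _ hDne]; ring
    have u2 : p - q * ((p * P + p' * Q) / (q * P + q' * Q))
        = (p * q' - p' * q) * Q / (q * P + q' * Q) := by
      rw [eq_div_iff hDne, sub_mul, mul_assoc, div_mul_cancel₀ _ hDne]; ring
    simp only [hF]; rw [u1, u2]; field_simp
  have habs : |P ^ 2 - b * P * Q - Q ^ 2| = 1 := by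
    rw [← sq_abs] at hN
    nlinarith [abs_nonneg (P ^ 2 - b * P * Q - Q ^ 2)]
  rw [e1, hdet, one_mul, Real.norm_eq_abs, abs_div, habs, abs_of_pos (by positivity)]
  apply one_div_le_one_div_of_le (by positivity)
  nlinarith

lemma height_bound (a : ℕ → ℤ) (K : ℕ) (b : ℤ) (hb : 2 ≤ b) (ha0 : a 0 = 0)
    (ha : ∀ i, 1 ≤ a (i + 1))
    (hconst : ∀ i, a (K + 2 + i) = b) (y : ℝ) (hy : IsCFValue a y) :
    1 ≤ algHeight y ∧ (algHeight y : ℝ) ≤ 4 * b * (convQ a (K + 1) : ℝ) ^ 2 := by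
  have hroot := quad_root a K b hb ha hconst y hy
  have hdet := conv_det a K
  have hy1 : |y| ≤ 1 := by
    rw [abs_of_nonneg]
    · refine le_of_tendsto hy (Eventually.of_forall fun m => ?_)
      apply div_le_one_of_le₀
      · exact_mod_cast convP_le_convQ a ha0 ha m
      · exact_mod_cast (zero_le_one.trans (convQ_pos a ha m))
    · refine ge_of_tendsto hy (Eventually.of_forall fun m => ?_)
      apply div_nonneg
      · exact_mod_cast convP_nonneg a ha0.ge ha m
      · exact_mod_cast (zero_le_one.trans (convQ_pos a ha m))
  have h1 := convP_nonneg a ha0.ge ha K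
  have h2 := convP_nonneg a ha0.ge ha (K + 1)
  have h3 := convP_le_convQ a ha0 ha K
  have h4 := convP_le_convQ a ha0 ha (K + 1)
  have h5 := convQ_mono a ha K
  have h6 := convQ_pos a ha K
  generalize convP a (K + 1) = p at *
  generalize convQ a (K + 1) = q at *
  generalize convP a K = p' at *
  generalize convQ a K = q' at *
  have hb0 : 0 ≤ b := by omega
  have hq0 : 0 ≤ q := by omega
  have hq'0 : 0 ≤ q' := by omega
  have hp' : p' ≤ q := by omega
  have bd : ∀ u v : ℤ, 0 ≤ u → u ≤ q → 0 ≤ v → v ≤ q → 0 ≤ u * v ∧ u * v ≤ q ^ 2 := by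
    intro u v hu hu' hv hv'
    refine ⟨by positivity, ?_⟩
    rw [sq]; gcongr
  have bdb : ∀ w : ℤ, 0 ≤ w ∧ w ≤ q ^ 2 → 0 ≤ b * w ∧ b * w ≤ b * q ^ 2 := by
    intro w hw
    exact ⟨mul_nonneg hb0 hw.1, mul_le_mul_of_nonneg_left hw.2 hb0⟩
  have hbig : 2 * q ^ 2 ≤ b * q ^ 2 := by gcongr
  have cast_eq : ((4 * b * q ^ 2).toNat : ℤ) = 4 * b * q ^ 2 :=
    Int.toNat_of_nonneg (by positivity)
  have key := algHeight_quad y hy1 (q' ^ 2 + b * (q * q') - q ^ 2)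
    (-2 * (q' * p') - b * (q' * p + p' * q) + 2 * (p * q)) (p' ^ 2 + b * (p * p') - p ^ 2)
    (by
      by_contra hcon
      push Not at hcon
      obtain ⟨hA, hB, hC⟩ := hcon
      have : (p * q' - p' * q) ^ 2 = (q' ^ 2 + b * (q * q') - q ^ 2) * p ^ 2
        + (-2 * (q' * p') - b * (q' * p + p' * q) + 2 * (p * q)) * p * q
        + (p' ^ 2 + b * (p * p') - p ^ 2) * q ^ 2 := by ring
      rw [hA, hB, hC, hdet] at this
      simp at this)
    (by push_cast; rw [← hroot]; ring) (4 * b * q ^ 2).toNat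
    (by
      rw [cast_eq, abs_le]
      have := bd q' q' hq'0 h5 hq'0 h5
      have := bdb _ (bd q q' hq0 le_rfl hq'0 h5)
      constructor <;> nlinarith)
    (by
      rw [cast_eq, abs_le]
      have := bd q' p' hq'0 h5 h1 hp'
      have := bd p q h2 h4 hq0 le_rfl
      have := bdb _ (bd q' p hq'0 h5 h2 h4)
      have := bdb _ (bd p' q h1 hp' hq0 le_rfl)
      constructor <;> nlinarith)
    (by
      rw [cast_eq, abs_le]
      have := bd p' p' h1 hp' h1 hp'
      have := bd p p h2 h4 h2 h4
      have := bdb _ (bd p p' h2 h4 h1 hp')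
      constructor <;> nlinarith)
  refine ⟨key.1, ?_⟩
  have : (algHeight y : ℤ) ≤ 4 * b * q ^ 2 := by
    rw [← cast_eq]; exact_mod_cast key.2
  exact_mod_cast this

/-! ### Growth of denominators along blocks -/

lemma convQ_block (a : ℕ → ℤ) (ha : ∀ i, 1 ≤ a (i + 1)) (s : ℕ) (b : ℤ) (hb : 1 ≤ b) (t : ℕ)
    (h : ∀ i, s < i → i ≤ s + t → a i = b) :
    b ^ t * convQ a s ≤ convQ a (s + t) ∧ convQ a (s + t) ≤ (b + 1) ^ t * convQ a s := by
  induction t with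
  | zero => simp
  | succ t ih =>
    obtain ⟨h1, h2⟩ := ih (fun i hi hi' => h i hi (by omega))
    have h3 := le_convQ_succ a ha (s + t)
    have h4 := convQ_succ_le a ha (s + t)
    have h5 : a (s + t + 1) = b := h _ (by omega) (by omega)
    rw [h5] at h3 h4
    rw [← add_assoc]
    constructor
    · refine le_trans ?_ h3
      rw [pow_succ']; rw [mul_assoc]; gcongr
    · refine le_trans h4 ?_
      rw [pow_succ', mul_assoc]; gcongr

lemma log_convQ_le (b lam : ℕ → ℕ) (hb : ∀ n, 0 < b n)
    (a : ℕ → ℤ) (ha : ∀ i, 1 ≤ a (i + 1))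
    (hblock : ∀ j i : ℕ, (∑ k ∈ Finset.range j, lam k) < i →
      i ≤ ∑ k ∈ Finset.range (j + 1), lam k → a i = (b j : ℤ)) (n : ℕ) :
    Real.log (convQ a (∑ k ∈ Finset.range n, lam k)) ≤
      ∑ k ∈ Finset.range n, (lam k : ℝ) * Real.log ((b k : ℝ) + 1) := by
  induction n with
  | zero => simp [convQ]
  | succ n ih =>
    rw [Finset.sum_range_succ, Finset.sum_range_succ]
    have h := (convQ_block a ha (∑ k ∈ Finset.range n, lam k) (b n) (by exact_mod_cast hb n)
      (lam n) (fun i hi hi' => hblock n i hi (by rw [Finset.sum_range_succ]; exact hi'))).2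
    have h' : (convQ a (∑ k ∈ Finset.range n, lam k + lam n) : ℝ) ≤
      ((b n : ℝ) + 1) ^ (lam n) * convQ a (∑ k ∈ Finset.range n, lam k) := by exact_mod_cast h
    have p1 : (1 : ℝ) ≤ convQ a (∑ k ∈ Finset.range n, lam k + lam n) := by
      exact_mod_cast convQ_pos a ha _
    have p2 : (1 : ℝ) ≤ convQ a (∑ k ∈ Finset.range n, lam k) := by
      exact_mod_cast convQ_pos a ha _
    have := Real.log_le_log (by linarith) h'
    rw [Real.log_mul (by positivity) (by positivity), Real.log_pow] at this
    linarith

lemma sum_log_bound (b lam : ℕ → ℕ) (hb : ∀ n, 0 < b n) (hbtop : Tendsto b atTop atTop) :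
    ∃ C : ℝ, ∀ n, ∑ k ∈ Finset.range n, (lam k : ℝ) * Real.log ((b k : ℝ) + 1) ≤
      2 * (∑ k ∈ Finset.range n, (lam k : ℝ) * Real.log (b k)) + C := by
  obtain ⟨k0, hk0⟩ := (hbtop.eventually_ge_atTop 2).exists_forall_of_atTop
  refine ⟨∑ k ∈ Finset.range k0, (lam k : ℝ) * Real.log 2, fun n => ?_⟩
  have hterm : ∀ k, (lam k : ℝ) * Real.log ((b k : ℝ) + 1) ≤
      2 * ((lam k : ℝ) * Real.log (b k)) + (if k < k0 then (lam k : ℝ) * Real.log 2 else 0) := by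
    intro k
    have hl : (0 : ℝ) ≤ lam k := Nat.cast_nonneg _
    have hbk : (1 : ℝ) ≤ b k := by exact_mod_cast hb k
    have hlog : 0 ≤ Real.log (b k) := Real.log_nonneg hbk
    split_ifs with hk
    · have : Real.log ((b k : ℝ) + 1) ≤ Real.log (2 * b k) :=
        Real.log_le_log (by linarith) (by linarith)
      rw [Real.log_mul (by norm_num) (by positivity)] at this
      nlinarith
    · have h2 : (2 : ℝ) ≤ b k := by exact_mod_cast hk0 k (not_lt.mp hk)
      have : Real.log ((b k : ℝ) + 1) ≤ Real.log ((b k : ℝ) ^ 2) :=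
        Real.log_le_log (by linarith) (by nlinarith)
      rw [Real.log_pow] at this
      push_cast at this
      nlinarith
  calc _ ≤ ∑ k ∈ Finset.range n, (2 * ((lam k : ℝ) * Real.log (b k))
          + (if k < k0 then (lam k : ℝ) * Real.log 2 else 0)) :=
        Finset.sum_le_sum fun k _ => hterm k
    _ = 2 * (∑ k ∈ Finset.range n, (lam k : ℝ) * Real.log (b k))
          + ∑ k ∈ (Finset.range n).filter (· < k0), (lam k : ℝ) * Real.log 2 := by
        rw [Finset.sum_add_distrib, Finset.mul_sum, Finset.sum_filter]
    _ ≤ _ := by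
        gcongr
        intro k hk
        simp at hk ⊢
        omega

lemma pos_of_blocks (b lam : ℕ → ℕ) (hb : ∀ n, 0 < b n) (hlam : ∀ n, 0 < lam n) (a : ℕ → ℤ)
    (hblock : ∀ j i : ℕ, (∑ k ∈ Finset.range j, lam k) < i →
      i ≤ ∑ k ∈ Finset.range (j + 1), lam k → a i = (b j : ℤ)) (i : ℕ) : 1 ≤ a (i + 1) := by
  have h1 : ∀ j, j ≤ ∑ k ∈ Finset.range j, lam k := by
    intro j
    induction j with
    | zero => simp
    | succ j ih => rw [Finset.sum_range_succ]; have := hlam j; omega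
  have h2 : ∀ j i, 1 ≤ i → i ≤ ∑ k ∈ Finset.range j, lam k → 1 ≤ a i := by
    intro j
    induction j with
    | zero => intro i hi hi'; simp at hi'; omega
    | succ j ih =>
      intro i hi hi'
      by_cases h : i ≤ ∑ k ∈ Finset.range j, lam k
      · exact ih i hi h
      · rw [hblock j i (not_le.mp h) hi']; exact_mod_cast hb j
  exact h2 (i + 1) (i + 1) (by omega) (h1 _)

/-- Under the growth hypotheses, with `α n = [0; b 0 ^ (lam 0), …, b n ^ (lam n),
overline{b (n+1)}]` the quadratic number agreeing with `ξ` up to the `n`-th block and then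
repeating `b (n+1)` forever, for all sufficiently large `n` one has
`0 < |ξ - α n| ≤ H(α n) ^ (-(2 * lam (n+1)) / 3)`. -/
theorem quasiPeriodic_quadratic_approx
    (b lam : ℕ → ℕ) (hb : ∀ n, 0 < b n) (hlam : ∀ n, 0 < lam n)
    (hbtop : Filter.Tendsto b Filter.atTop Filter.atTop)
    (hlamtop : Filter.Tendsto lam Filter.atTop Filter.atTop)
    (hgrow : Filter.Tendsto (fun n => Real.log (b (n + 1)) /
        ∑ k ∈ Finset.range (n + 1), (lam k : ℝ) * Real.log (b k))
      Filter.atTop Filter.atTop)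
    (a : ℕ → ℤ) (ha0 : a 0 = 0)
    (hblock : ∀ j i : ℕ, (∑ k ∈ Finset.range j, lam k) < i →
      i ≤ ∑ k ∈ Finset.range (j + 1), lam k → a i = (b j : ℤ))
    (ξ : ℝ) (hξ : IsCFValue a ξ)
    (α : ℕ → ℝ)
    (hα : ∀ n : ℕ, IsCFValue
      (fun i => if i ≤ ∑ k ∈ Finset.range (n + 2), lam k then a i else (b (n + 1) : ℤ))
      (α n))
    : ∀ᶠ n in Filter.atTop,
        0 < |ξ - α n| ∧ |ξ - α n| ≤ (algHeight (α n) : ℝ) ^ (-(2 * (lam (n + 1) : ℝ)) / 3) := by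
  have ha := pos_of_blocks b lam hb hlam a hblock
  obtain ⟨C, hC⟩ := sum_log_bound b lam hb hbtop
  have hbtop1 : Tendsto (fun n => b (n + 1)) atTop atTop := (tendsto_add_atTop_iff_nat 1).mpr hbtop
  have hlogtop : Tendsto (fun n => Real.log (b (n + 1))) atTop atTop :=
    Real.tendsto_log_atTop.comp (tendsto_natCast_atTop_atTop.comp hbtop1)
  have hgrow1 := (tendsto_add_atTop_iff_nat 1).mpr hgrow
  filter_upwards [hbtop1.eventually_ge_atTop 2, hgrow.eventually_ge_atTop 8,
    hgrow1.eventually_ge_atTop 2, hlogtop.eventually_ge_atTop (2 * (C + Real.log 2))]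
    with n hb2 hg hg1 hlogC
  -- block sums
  obtain ⟨K, hK⟩ : ∃ K, ∑ k ∈ Finset.range (n + 1), lam k = K + 1 :=
    ⟨∑ k ∈ Finset.range (n + 1), lam k - 1, by
      rw [Finset.sum_range_succ]; have := hlam n; omega⟩
  obtain ⟨N, hN⟩ : ∃ N, ∑ k ∈ Finset.range (n + 2), lam k = N + 1 :=
    ⟨∑ k ∈ Finset.range (n + 2), lam k - 1, by
      rw [Finset.sum_range_succ]; have := hlam (n + 1); omega⟩
  have hKN : N + 1 = K + 1 + lam (n + 1) := by rw [← hN, Finset.sum_range_succ, hK]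
  have hval := hα n
  rw [hN] at hval
  set a' : ℕ → ℤ := fun i => if i ≤ N + 1 then a i else (b (n + 1) : ℤ) with ha'def
  have ha'low : ∀ i ≤ N + 1, a' i = a i := fun i hi => by simp [ha'def, hi]
  have ha'high : ∀ i, K + 1 < i → a' i = (b (n + 1) : ℤ) := by
    intro i hi
    by_cases h : i ≤ N + 1
    · rw [ha'low i h]
      exact hblock (n + 1) i (by rw [hK]; exact hi) (by rw [hN]; exact h)
    · simp [ha'def, h]
  have ha' : ∀ i, 1 ≤ a' (i + 1) := by
    intro i
    by_cases h : i + 1 ≤ N + 1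
    · rw [ha'low _ h]; exact ha i
    · rw [ha'high _ (by omega)]; omega
  have ha'0 : a' 0 = 0 := by rw [ha'low 0 (by omega), ha0]
  -- logarithmic estimates
  have hB2 : (2 : ℝ) ≤ b (n + 1) := by exact_mod_cast hb2
  have hlogB : 0 < Real.log (b (n + 1)) := Real.log_pos (by linarith)
  have hterm : ∀ k, 0 ≤ (lam k : ℝ) * Real.log (b k) := fun k => by positivity
  have hbn2 : b (n + 1) + 1 ≤ b (n + 2) := by
    have hs : Real.log (b (n + 1)) ≤ ∑ k ∈ Finset.range (n + 2), (lam k : ℝ) * Real.log (b k) := by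
      rw [Finset.sum_range_succ]
      have h1 : 0 ≤ ∑ k ∈ Finset.range (n + 1), (lam k : ℝ) * Real.log (b k) :=
        Finset.sum_nonneg fun k _ => hterm k
      have h2 : (1 : ℝ) ≤ lam (n + 1) := by exact_mod_cast hlam (n + 1)
      nlinarith
    have hg1' := (le_div_iff₀ (by linarith)).mp hg1
    have : Real.log (b (n + 1)) < Real.log (b (n + 2)) := by
      have e : n + 1 + 1 = n + 2 := rfl
      rw [e] at hg1'
      linarith
    have h3 := (Real.log_lt_log_iff (by linarith) (by exact_mod_cast hb (n + 2))).mp this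
    exact_mod_cast h3
  have hq : 2 * (convQ a (K + 1) : ℝ) ≤ b (n + 1) := by
    have h1 := log_convQ_le b lam hb a ha hblock (n + 1)
    have h2 := hC (n + 1)
    have hs : 0 ≤ ∑ k ∈ Finset.range (n + 1), (lam k : ℝ) * Real.log (b k) :=
      Finset.sum_nonneg fun k _ => hterm k
    have hs' : 0 < ∑ k ∈ Finset.range (n + 1), (lam k : ℝ) * Real.log (b k) := by
      refine lt_of_le_of_ne hs fun h0 => ?_
      rw [← h0, div_zero] at hg
      norm_num at hg
    have h3 := (le_div_iff₀ hs').mp hg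
    rw [hK] at h1
    have hpos : (1 : ℝ) ≤ convQ a (K + 1) := by exact_mod_cast convQ_pos a ha (K + 1)
    rw [← Real.log_le_log_iff (by linarith) (by linarith),
      Real.log_mul (by norm_num) (by linarith)]
    linarith
  have hqpos : (1 : ℝ) ≤ convQ a (K + 1) := by exact_mod_cast convQ_pos a ha (K + 1)
  -- height bound
  obtain ⟨hH1, hH2⟩ := height_bound a' K (b (n + 1)) (by exact_mod_cast hb2) ha'0 ha'
    (fun i => ha'high _ (by omega)) (α n) hval
  rw [convQ_congr a' a (K + 1) (fun i hi => ha'low i (by omega))] at hH2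
  have hH3 : (algHeight (α n) : ℝ) ≤ (b (n + 1) : ℝ) ^ 3 := by
    refine hH2.trans ?_
    push_cast
    have : (2 * (convQ a (K + 1) : ℝ)) ^ 2 ≤ (b (n + 1) : ℝ) ^ 2 := by gcongr
    nlinarith
  have hH1' : (1 : ℝ) ≤ algHeight (α n) := by exact_mod_cast hH1
  -- approximation
  obtain ⟨hup, hlow⟩ := approx a a' N ha ha' ha'low ξ (α n) hξ hval
  constructor
  · apply hlow
    · rw [ha'high _ (by omega), hblock (n + 2) (N + 2) (by rw [hN]; omega)
        (by rw [Finset.sum_range_succ, hN]; have := hlam (n + 2); omega)]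
      exact_mod_cast hbn2
    · rw [ha'high _ (by omega)]; exact_mod_cast hb2
  · refine hup.trans ?_
    have hblk := (convQ_block a ha (K + 1) (b (n + 1)) (by exact_mod_cast hb (n + 1))
      (lam (n + 1)) (fun i hi hi' => hblock (n + 1) i (by rw [hK]; exact hi)
        (by rw [hN, hKN]; exact hi'))).1
    rw [← hKN] at hblk
    have hblk' : (b (n + 1) : ℝ) ^ lam (n + 1) * convQ a (K + 1) ≤ convQ a (N + 1) := by
      exact_mod_cast hblk
    have hbpow : (0 : ℝ) < (b (n + 1) : ℝ) ^ lam (n + 1) := by positivity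
    have hblk2 : (b (n + 1) : ℝ) ^ lam (n + 1) ≤ convQ a (N + 1) := by nlinarith
    have hstep : ((b (n + 1) : ℝ) ^ 3) ^ (-(2 * (lam (n + 1) : ℝ)) / 3)
        = 1 / ((b (n + 1) : ℝ) ^ lam (n + 1)) ^ 2 := by
      rw [← Real.rpow_natCast (b (n + 1) : ℝ) 3, ← Real.rpow_mul (by positivity), ← pow_mul,
        one_div, ← Real.rpow_natCast, ← Real.rpow_neg (by positivity)]
      congr 1
      push_cast
      ring
    calc 1 / (convQ a (N + 1) : ℝ) ^ 2 ≤ 1 / ((b (n + 1) : ℝ) ^ lam (n + 1)) ^ 2 := by gcongr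
      _ = ((b (n + 1) : ℝ) ^ 3) ^ (-(2 * (lam (n + 1) : ℝ)) / 3) := hstep.symm
      _ ≤ _ := by
        apply Real.rpow_le_rpow_of_nonpos (by linarith) hH3
        have : (0 : ℝ) ≤ lam (n + 1) := Nat.cast_nonneg _
        linarith
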